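/- Let P be a symmetric N×N matrix with P·1 = 1, and suppose the product (I - w₂L)(I - w₁L) with L = I - P equals the averaging projection (1/N)·11ᵀ for some real w₁, w₂. Then the graph of P (edges where off-diagonal entries are nonzero) has diameter at most 2. -/

import Mathlib

open Matrix

/-- If `(I - w₂L)(I - w₁L)` with `L = I - P` equals the averaging projection, then the graph
of `P` (edges at nonzero off-diagonal entries) has diameter at most 2. -/
theorem two_step_consensus_diameter_le_two {N : ℕ}
    (P : Matrix (Fin N) (Fin N) ℝ) (hsymm : P.IsSymm) (hP1 : P *ᵥ 1 = 1)
    (w₁ w₂ : ℝ)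
    (hprod : (1 - w₂ • ((1 : Matrix (Fin N) (Fin N) ℝ) - P)) *
        (1 - w₁ • ((1 : Matrix (Fin N) (Fin N) ℝ) - P)) =
      (N : ℝ)⁻¹ • Matrix.of (fun _ _ => (1 : ℝ))) :
    ∀ i j : Fin N, i ≠ j →
      P i j ≠ 0 ∨ ∃ k : Fin N, k ≠ i ∧ k ≠ j ∧ P i k ≠ 0 ∧ P k j ≠ 0 := by
  intro i j hij
  by_contra hcon
  push Not at hcon
  obtain ⟨h0, hk⟩ := hcon
  have hN : (N : ℝ) ≠ 0 := by
    have := i.pos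
    positivity
  have h := congrFun (congrFun hprod i) j
  rw [Matrix.mul_apply, Finset.sum_eq_zero] at h
  · simp at h
    exact hN (by exact_mod_cast h.symm)
  · intro k _
    by_cases hki : k = i
    · subst hki
      simp [h0, Matrix.one_apply_ne hij]
    · by_cases hkj : k = j
      · subst hkj
        simp [h0, Matrix.one_apply_ne hij]
      · by_cases hp : P i k = 0
        · simp [hp, Matrix.one_apply_ne (Ne.symm hki)]
        · simp [hk k hki hkj hp, Matrix.one_apply_ne hkj]
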